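/- arXiv:1703.10229 — 6 statements merged into one kernel-verified Lean document; each statement's English description precedes it below -/
import Mathlib

section
/- Let m and q be coprime positive integers such that m divides (q+1)². Then there exist positive integers d, n, a with gcd(n, a) = 1 such that m = d·n² and q + 1 = d·n·a. Conversely, if m = d·n² and q + 1 = d·n·a for positive integers d, n, a with gcd(n, a) = 1, then gcd(m, q) = 1 and m divides (q+1)². -/
/-- T-singularity arithmetic: m ∣ (q+1)² with gcd(m,q)=1 iff m = dn², q+1 = dna with gcd(n,a)=1. -/
theorem T_singularity_arith (m q : ℕ) (hm : 0 < m) (hq : 0 < q) :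
    (Nat.Coprime m q ∧ m ∣ (q + 1) ^ 2) ↔
      ∃ d n a : ℕ, 0 < d ∧ 0 < n ∧ 0 < a ∧ Nat.Coprime n a ∧
        m = d * n ^ 2 ∧ q + 1 = d * n * a := by
  constructor
  · rintro ⟨-, hdvd⟩
    have hg : 0 < Nat.gcd m (q + 1) := Nat.gcd_pos_of_pos_left _ hm
    obtain ⟨n, a, hco, h1, h2⟩ := Nat.exists_coprime m (q + 1)
    generalize Nat.gcd m (q + 1) = g at *
    have h3 : n ∣ g * a ^ 2 := by
      rw [h1, h2] at hdvd
      have : g * n ∣ g * (g * a ^ 2) := by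
        convert hdvd using 1 <;> ring
      exact Nat.dvd_of_mul_dvd_mul_left hg this
    obtain ⟨d, rfl⟩ := (Nat.Coprime.pow_right 2 hco).dvd_of_dvd_mul_right h3
    refine ⟨d, n, a, Nat.pos_of_mul_pos_left hg, Nat.pos_of_mul_pos_right hg, ?_, hco, ?_, ?_⟩
    · rcases Nat.eq_zero_or_pos a with h | h
      · subst h
        simp at h2
      · exact h
    · rw [h1]; ring
    · rw [h2]; ring
  · rintro ⟨d, n, a, -, -, -, -, h1, h2⟩
    have hdvd : m ∣ (q + 1) ^ 2 := ⟨d * a ^ 2, by rw [h1, h2]; ring⟩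
    refine ⟨Nat.Coprime.coprime_dvd_left hdvd (Nat.Coprime.pow_left 2 ?_), hdvd⟩
    simp
end

section
/- Let ζ ∈ ℂ be a primitive 5th root of unity, and let r, k, l, m be integers none of which is divisible by 5. Then 1/((1 − ζ^r)(1 − ζ^k)) + 1/((1 − ζ^l)(1 − ζ^m)) = 1 holds if and only if, modulo 5, the unordered pair of unordered pairs {{r, k}, {l, m}} equals {{1, 4}, {2, 3}} — that is, either ({r mod 5, k mod 5} = {1, 4} and {l mod 5, m mod 5} = {2, 3}) or ({r mod 5, k mod 5} = {2, 3} and {l mod 5, m mod 5} = {1, 4}). -/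
open Polynomial in
theorem aux_indep (ζ : ℂ) (hζ : IsPrimitiveRoot ζ 5) (a b c d : ℤ)
    (h : (a : ℂ) + b * ζ + c * ζ ^ 2 + d * ζ ^ 3 = 0) : a = 0 ∧ b = 0 ∧ c = 0 ∧ d = 0 := by
  let p : ℚ[X] := C (d : ℚ) * X ^ 3 + C (c : ℚ) * X ^ 2 + C (b : ℚ) * X + C (a : ℚ)
  have hp : p = 0 := by
    by_contra hne
    have h1 : aeval ζ p = 0 := by
      simp [p]
      linear_combination h
    have h2 := Polynomial.natDegree_le_of_dvd (minpoly.dvd ℚ ζ h1) hne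
    rw [← cyclotomic_eq_minpoly_rat hζ (by norm_num), natDegree_cyclotomic,
      Nat.totient_prime (by norm_num)] at h2
    have h3 : p.natDegree ≤ 3 := natDegree_cubic_le
    omega
  have e : ∀ n, p.coeff n = 0 := by simp [hp]
  have e0 := e 0
  have e1 := e 1
  have e2 := e 2
  have e3 := e 3
  simp [p, coeff_X, coeff_C, -map_intCast, -eq_intCast] at e0 e1 e2 e3
  exact ⟨e0, e1, e2, e3⟩

def ev5 (ζ : ℂ) (v : ℤ × ℤ × ℤ × ℤ) : ℂ :=
  v.1 + v.2.1 * ζ + v.2.2.1 * ζ ^ 2 + v.2.2.2 * ζ ^ 3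

def mul5 (v w : ℤ × ℤ × ℤ × ℤ) : ℤ × ℤ × ℤ × ℤ :=
  let c4 := v.2.1 * w.2.2.2 + v.2.2.1 * w.2.2.1 + v.2.2.2 * w.2.1
  (v.1 * w.1 + v.2.2.1 * w.2.2.2 + v.2.2.2 * w.2.2.1 - c4,
   v.1 * w.2.1 + v.2.1 * w.1 + v.2.2.2 * w.2.2.2 - c4,
   v.1 * w.2.2.1 + v.2.1 * w.2.1 + v.2.2.1 * w.1 - c4,
   v.1 * w.2.2.2 + v.2.1 * w.2.2.1 + v.2.2.1 * w.2.1 + v.2.2.2 * w.1 - c4)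

def q5 (r : ℤ) : ℤ × ℤ × ℤ × ℤ :=
  if r = 1 then (4, 3, 2, 1) else if r = 2 then (2, -1, 1, -2)
  else if r = 3 then (3, 1, -1, 2) else (1, -3, -2, -1)

theorem ev5_mul (ζ : ℂ) (h : 1 + ζ + ζ ^ 2 + ζ ^ 3 + ζ ^ 4 = 0) (v w : ℤ × ℤ × ℤ × ℤ) :
    ev5 ζ (mul5 v w) = ev5 ζ v * ev5 ζ w := by
  obtain ⟨a, b, c, d⟩ := v
  obtain ⟨a', b', c', d'⟩ := w
  simp only [ev5, mul5]
  push_cast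
  linear_combination (-(b * d' + c * c' + d * b' : ℂ) - (c * d' + d * c') * (ζ - 1)
    - d * d' * (ζ ^ 2 - ζ)) * h

theorem inv5 (ζ : ℂ) (hζ : IsPrimitiveRoot ζ 5) (h : 1 + ζ + ζ ^ 2 + ζ ^ 3 + ζ ^ 4 = 0)
    (r : ℤ) (hr : ¬ (5 : ℤ) ∣ r) : (1 - ζ ^ r)⁻¹ = ev5 ζ (q5 (r % 5)) / 5 := by
  have h5 : ζ ^ 5 = 1 := hζ.pow_eq_one
  have hz : ζ ≠ 0 := hζ.ne_zero (by norm_num)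
  have e : ζ ^ r = ζ ^ (r % 5) := by
    conv_lhs => rw [← Int.emod_add_mul_ediv r 5, zpow_add₀ hz, zpow_mul]
    have : ζ ^ (5 : ℤ) = 1 := by exact_mod_cast h5
    simp [this]
  rw [e]
  apply inv_eq_of_mul_eq_one_right
  rw [← mul_div_assoc, div_eq_one_iff_eq (by norm_num)]
  have : r % 5 = 1 ∨ r % 5 = 2 ∨ r % 5 = 3 ∨ r % 5 = 4 := by omega
  have z1 : ζ ^ (1 : ℤ) = ζ := zpow_one ζ
  have z2 : ζ ^ (2 : ℤ) = ζ ^ 2 := by norm_cast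
  have z3 : ζ ^ (3 : ℤ) = ζ ^ 3 := by norm_cast
  have z4 : ζ ^ (4 : ℤ) = ζ ^ 4 := by norm_cast
  rcases this with h' | h' | h' | h' <;> rw [h']
  · rw [z1]
    norm_num [q5, ev5]
    linear_combination (-1) * h
  · rw [z2]
    norm_num [q5, ev5]
    linear_combination (2 * ζ - 3) * h
  · rw [z3]
    norm_num [q5, ev5]
    linear_combination (-2 * ζ ^ 2 + 3 * ζ - 2) * h
  · rw [z4]
    norm_num [q5, ev5]
    linear_combination (-4 + ζ + ζ ^ 2 + ζ ^ 3) * h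

theorem fin5 : ∀ a ∈ ({1, 2, 3, 4} : Finset ℤ), ∀ b ∈ ({1, 2, 3, 4} : Finset ℤ),
    ∀ c ∈ ({1, 2, 3, 4} : Finset ℤ), ∀ d ∈ ({1, 2, 3, 4} : Finset ℤ),
    (mul5 (q5 a) (q5 b) + mul5 (q5 c) (q5 d) = (25, 0, 0, 0) ↔
      ((((a = 1 ∧ b = 4) ∨ (a = 4 ∧ b = 1)) ∧
        ((c = 2 ∧ d = 3) ∨ (c = 3 ∧ d = 2))) ∨
       (((a = 2 ∧ b = 3) ∨ (a = 3 ∧ b = 2)) ∧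
        ((c = 1 ∧ d = 4) ∨ (c = 4 ∧ d = 1))))) := by
  decide +kernel

/-- Holomorphic Lefschetz computation for an order-5 automorphism with two fixed points. -/
theorem lefschetz_order_five (ζ : ℂ) (hζ : IsPrimitiveRoot ζ 5)
    (r k l m : ℤ)
    (hr : ¬ (5 : ℤ) ∣ r) (hk : ¬ (5 : ℤ) ∣ k)
    (hl : ¬ (5 : ℤ) ∣ l) (hm : ¬ (5 : ℤ) ∣ m) :
    1 / ((1 - ζ ^ r) * (1 - ζ ^ k)) + 1 / ((1 - ζ ^ l) * (1 - ζ ^ m)) = 1 ↔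
      ((((r % 5 = 1 ∧ k % 5 = 4) ∨ (r % 5 = 4 ∧ k % 5 = 1)) ∧
        ((l % 5 = 2 ∧ m % 5 = 3) ∨ (l % 5 = 3 ∧ m % 5 = 2))) ∨
       (((r % 5 = 2 ∧ k % 5 = 3) ∨ (r % 5 = 3 ∧ k % 5 = 2)) ∧
        ((l % 5 = 1 ∧ m % 5 = 4) ∨ (l % 5 = 4 ∧ m % 5 = 1)))) := by
  have h : 1 + ζ + ζ ^ 2 + ζ ^ 3 + ζ ^ 4 = 0 := by
    have := hζ.geom_sum_eq_zero (by norm_num)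
    simpa [Finset.sum_range_succ] using this
  have mem : ∀ x : ℤ, ¬ (5 : ℤ) ∣ x → x % 5 ∈ ({1, 2, 3, 4} : Finset ℤ) := by
    intro x hx
    simp only [Finset.mem_insert, Finset.mem_singleton]
    omega
  rw [← fin5 _ (mem r hr) _ (mem k hk) _ (mem l hl) _ (mem m hm)]
  simp only [one_div, mul_inv]
  rw [inv5 ζ hζ h r hr, inv5 ζ hζ h k hk, inv5 ζ hζ h l hl, inv5 ζ hζ h m hm]
  have e : ∀ a b c d : ℂ, a / 5 * (b / 5) + c / 5 * (d / 5) = 1 ↔ a * b + c * d = 25 := by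
    intro a b c d
    constructor <;> intro h
    · linear_combination 25 * h
    · linear_combination h / 25
  rw [e, ← ev5_mul ζ h, ← ev5_mul ζ h]
  generalize mul5 (q5 (r % 5)) (q5 (k % 5)) = v
  generalize mul5 (q5 (l % 5)) (q5 (m % 5)) = w
  obtain ⟨a, b, c, d⟩ := v
  obtain ⟨a', b', c', d'⟩ := w
  simp only [ev5, Prod.mk_add_mk, Prod.mk.injEq]
  constructor
  · intro H
    have := aux_indep ζ hζ (a + a' - 25) (b + b') (c + c') (d + d') (by
      push_cast
      linear_combination H)
    omega
  · rintro ⟨h0, h1, h2, h3⟩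
    have h0 : (a + a' : ℂ) = 25 := by exact_mod_cast h0
    have h1 : (b + b' : ℂ) = 0 := by exact_mod_cast h1
    have h2 : (c + c' : ℂ) = 0 := by exact_mod_cast h2
    have h3 : (d + d' : ℂ) = 0 := by exact_mod_cast h3
    linear_combination h0 + ζ * h1 + ζ ^ 2 * h2 + ζ ^ 3 * h3
end

section
/- Define f : ℂ³ → ℂ³ by f(u₀, u₁, u₂) = (u₀(u₂ − u₁), u₂(u₀ − u₁), u₀u₂), and let f⁵ denote the 5-fold iterate f ∘ f ∘ f ∘ f ∘ f. Then for every u ∈ ℂ³ and all indices i, j ∈ {0, 1, 2}, one has (f⁵(u))_i · u_j = (f⁵(u))_j · u_i; that is, f⁵(u) is always proportional to u, so the Cremona transformation of ℙ² induced by f satisfies α⁵ = id. -/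
/-- The quadratic Cremona transformation of Example 5.3. -/
noncomputable def cremona (u : Fin 3 → ℂ) : Fin 3 → ℂ :=
  ![u 0 * (u 2 - u 1), u 2 * (u 0 - u 1), u 0 * u 2]

theorem cremona_vec (a b c : ℂ) :
    cremona ![a, b, c] = ![a * (c - b), c * (a - b), a * c] := by
  simp [cremona]

theorem cremona_smul (k : ℂ) (v : Fin 3 → ℂ) : cremona (k • v) = k ^ 2 • cremona v := by
  funext i
  fin_cases i <;> simp [cremona] <;> ring

theorem cremona_five (a b c : ℂ) : ∃ k : ℂ, cremona^[5] ![a, b, c] = k • ![a, b, c] := by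
  have h2 : cremona (cremona ![a, b, c])
      = (a * c) • ![b * (c - b), b * (c - a), a * (c - b)] := by
    rw [cremona_vec, cremona_vec]
    funext i
    fin_cases i <;> simp [-mul_eq_mul_left_iff, -mul_eq_mul_right_iff] <;> ring
  have h3 : cremona ![b * (c - b), b * (c - a), a * (c - b)]
      = (b * (c - b)) • ![c * (a - b), a * (a - b), a * (c - b)] := by
    rw [cremona_vec]
    funext i
    fin_cases i <;> simp [-mul_eq_mul_left_iff, -mul_eq_mul_right_iff] <;> ring
  have h4 : cremona ![c * (a - b), a * (a - b), a * (c - b)]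
      = (a * (a - b)) • ![c * (c - a), (c - b) * (c - a), c * (c - b)] := by
    rw [cremona_vec]
    funext i
    fin_cases i <;> simp [-mul_eq_mul_left_iff, -mul_eq_mul_right_iff] <;> ring
  have h5 : cremona ![c * (c - a), (c - b) * (c - a), c * (c - b)]
      = (c * (c - a) * (c - b)) • ![a, b, c] := by
    rw [cremona_vec]
    funext i
    fin_cases i <;> simp [-mul_eq_mul_left_iff, -mul_eq_mul_right_iff] <;> ring
  simp only [Function.iterate_succ, Function.iterate_zero, Function.comp_apply, id]
  rw [h2, cremona_smul, h3, smul_smul, cremona_smul, h4, smul_smul, cremona_smul, h5, smul_smul]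
  exact ⟨_, rfl⟩

/-- The 5-th iterate of the Cremona map is projectively the identity. -/
theorem cremona_pow_five_proportional (u : Fin 3 → ℂ) (i j : Fin 3) :
    (cremona^[5] u) i * u j = (cremona^[5] u) j * u i := by
  obtain ⟨k, hk⟩ := cremona_five (u 0) (u 1) (u 2)
  have hu : ![u 0, u 1, u 2] = u := by
    funext i
    fin_cases i <;> rfl
  rw [hu] at hk
  rw [hk]
  simp only [Pi.smul_apply, smul_eq_mul]
  ring
end

section
/- Let σ : ℂ² → ℂ² be the coordinate swap σ(x₀, x₁) = (x₁, x₀), let S be the set of triples (u, v, w) of nonzero vectors in ℂ² satisfying u₁v₁w₁ = u₀v₀w₀, let α(u, v, w) = (σv, σw, σu), and say two triples of nonzero vectors in ℂ² are projectively equal if in each factor the corresponding vectors x, y satisfy x₀y₁ = x₁y₀. Then a triple (u, v, w) ∈ S is projectively equal to α(u, v, w) if and only if each of u, v, w is a nonzero scalar multiple of (1, 1); that is, P = ((1,1),(1,1),(1,1)) is, up to projective equality, the unique fixed point of α on S. -/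
/-- Coordinate swap on ℂ². -/
def swapC (x : ℂ × ℂ) : ℂ × ℂ := (x.2, x.1)

/-- The automorphism α of Example 5.1: α(u, v, w) = (σv, σw, σu). -/
def alphaDP6 (p : (ℂ × ℂ) × (ℂ × ℂ) × (ℂ × ℂ)) : (ℂ × ℂ) × (ℂ × ℂ) × (ℂ × ℂ) :=
  (swapC p.2.1, swapC p.2.2, swapC p.1)

/-- Projective equality of two nonzero vectors in ℂ². -/
def projEq2 (x y : ℂ × ℂ) : Prop := x.1 * y.2 = x.2 * y.1

/-- Projective equality of two triples. -/
def projEq3 (p q : (ℂ × ℂ) × (ℂ × ℂ) × (ℂ × ℂ)) : Prop :=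
  projEq2 p.1 q.1 ∧ projEq2 p.2.1 q.2.1 ∧ projEq2 p.2.2 q.2.2

/-- P = (1:1; 1:1; 1:1) is the unique fixed point of α on S, up to projective equality. -/
theorem alphaDP6_unique_fixed_point (u v w : ℂ × ℂ)
    (hu : u ≠ 0) (hv : v ≠ 0) (hw : w ≠ 0)
    (hS : u.2 * v.2 * w.2 = u.1 * v.1 * w.1) :
    projEq3 (u, v, w) (alphaDP6 (u, v, w)) ↔
      ((∃ c : ℂ, c ≠ 0 ∧ u = (c, c)) ∧ (∃ c : ℂ, c ≠ 0 ∧ v = (c, c)) ∧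
        (∃ c : ℂ, c ≠ 0 ∧ w = (c, c))) := by
  obtain ⟨a, b⟩ := u
  obtain ⟨c, d⟩ := v
  obtain ⟨e, f⟩ := w
  simp only [projEq3, projEq2, alphaDP6, swapC, Prod.mk.injEq, ne_eq, Prod.mk_eq_zero] at *
  constructor
  · rintro ⟨h1, h2, h3⟩
    have hac : a * c ≠ 0 := by
      intro h
      rw [h] at h1
      have h1' := h1.symm
      rw [mul_eq_zero] at h h1'
      grind
    have hef : e = f := by
      apply mul_left_cancel₀ hac
      linear_combination -hS - f * h1
    subst hef
    have he : e ≠ 0 := fun h => hw ⟨h, h⟩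
    have hcd : c = d := mul_right_cancel₀ he h2
    have hab : a = b := mul_left_cancel₀ he (by linear_combination h3)
    subst hcd hab
    exact ⟨⟨a, by simpa using hu, rfl, rfl⟩, ⟨c, by simpa using hv, rfl, rfl⟩, ⟨e, he, rfl, rfl⟩⟩
  · rintro ⟨⟨x, -, rfl, rfl⟩, ⟨y, -, rfl, rfl⟩, ⟨z, -, rfl, rfl⟩⟩
    exact ⟨rfl, rfl, rfl⟩
end

section
/- Let S be the set of triples (u, v, w) of nonzero vectors in ℂ² satisfying u₁v₁w₁ = u₀v₀w₀, and say two triples of nonzero vectors in ℂ² are projectively equal if in each factor the corresponding vectors x, y satisfy x₀y₁ = x₁y₀. Then a triple (u, v, w) ∈ S is projectively equal to (w, u, v) if and only if there is a cube root of unity ω ∈ ℂ such that each of u, v, w is a nonzero scalar multiple of (1, ω). In particular, up to projective equality there are exactly three such fixed points on S. -/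
/-- Fixed points of α² = cyclic shift on the degree-6 del Pezzo surface:
exactly the three diagonal points (1:ω; 1:ω; 1:ω) with ω³ = 1. -/
theorem alphaDP6_sq_fixed_points (u v w : ℂ × ℂ)
    (hu : u ≠ 0) (hv : v ≠ 0) (hw : w ≠ 0)
    (hS : u.2 * v.2 * w.2 = u.1 * v.1 * w.1) :
    projEq3 (u, v, w) (w, u, v) ↔
      ∃ ω : ℂ, ω ^ 3 = 1 ∧
        (∃ c : ℂ, c ≠ 0 ∧ u = (c, c * ω)) ∧
        (∃ c : ℂ, c ≠ 0 ∧ v = (c, c * ω)) ∧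
        (∃ c : ℂ, c ≠ 0 ∧ w = (c, c * ω)) := by
  obtain ⟨a, b⟩ := u
  obtain ⟨c, d⟩ := v
  obtain ⟨e, f⟩ := w
  simp only [projEq3, projEq2, ne_eq, Prod.mk_eq_zero, not_and, Prod.mk.injEq] at *
  constructor
  · rintro ⟨h1, h2, h3⟩
    have ha : a ≠ 0 := by
      intro ha
      have hb := hu ha
      have he : e = 0 := by
        have h : b * e = 0 := by rw [← h1, ha, zero_mul]
        exact (mul_eq_zero.mp h).resolve_left hb
      have hc : c = 0 := by
        have h : c * b = 0 := by rw [h2, ha, mul_zero]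
        exact (mul_eq_zero.mp h).resolve_right hb
      have h : b * d * f = 0 := by rw [hS, ha]; ring
      exact mul_ne_zero (mul_ne_zero hb (hv hc)) (hw he) h
    have hd : d = c * (b / a) := by
      field_simp
      linear_combination -h2
    have hf : f = e * (b / a) := by
      field_simp
      linear_combination h1
    have hc : c ≠ 0 := by
      intro hc
      exact hv hc (by rw [hd, hc, zero_mul])
    have he : e ≠ 0 := by
      intro he
      exact hw he (by rw [hf, he, zero_mul])
    have hb : b = a * (b / a) := by field_simp
    refine ⟨b / a, ?_, ⟨a, ha, rfl, hb⟩, ⟨c, hc, rfl, hd⟩, ⟨e, he, rfl, hf⟩⟩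
    generalize b / a = t at *
    subst hb hd hf
    have hk : a * c * e ≠ 0 := mul_ne_zero (mul_ne_zero ha hc) he
    apply mul_left_cancel₀ hk
    linear_combination hS
  · rintro ⟨t, -, ⟨x, -, rfl, rfl⟩, ⟨y, -, rfl, rfl⟩, ⟨z, -, rfl, rfl⟩⟩
    refine ⟨?_, ?_, ?_⟩ <;> ring
end

section
/- Let σ : ℂ² → ℂ² be the coordinate swap σ(x₀, x₁) = (x₁, x₀), let S be the set of triples (u, v, w) of nonzero vectors in ℂ² satisfying u₁v₁w₁ = u₀v₀w₀, and say two triples of nonzero vectors in ℂ² are projectively equal if in each factor the corresponding vectors x, y satisfy x₀y₁ = x₁y₀. Then a triple (u, v, w) ∈ S is projectively equal to (σu, σv, σw) if and only if each of u, v, w is a nonzero scalar multiple of (1, 1) or of (1, −1), and the number of factors proportional to (1, −1) is even (zero or two). In particular, up to projective equality there are exactly four such fixed points on S. -/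
/-- Fixed points of α³ = (σ, σ, σ) on the degree-6 del Pezzo surface: each factor
proportional to (1,1) or (1,−1), with an even number of factors proportional to (1,−1). -/
theorem alphaDP6_cube_fixed_points (u v w : ℂ × ℂ)
    (hu : u ≠ 0) (hv : v ≠ 0) (hw : w ≠ 0)
    (hS : u.2 * v.2 * w.2 = u.1 * v.1 * w.1) :
    projEq3 (u, v, w) (swapC u, swapC v, swapC w) ↔
      ∃ ε₁ ε₂ ε₃ : ℂ,
        (ε₁ = 1 ∨ ε₁ = -1) ∧ (ε₂ = 1 ∨ ε₂ = -1) ∧ (ε₃ = 1 ∨ ε₃ = -1) ∧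
        ε₁ * ε₂ * ε₃ = 1 ∧
        (∃ c : ℂ, c ≠ 0 ∧ u = (c, c * ε₁)) ∧
        (∃ c : ℂ, c ≠ 0 ∧ v = (c, c * ε₂)) ∧
        (∃ c : ℂ, c ≠ 0 ∧ w = (c, c * ε₃)) := by
  have key : ∀ x : ℂ × ℂ, x ≠ 0 → projEq2 x (swapC x) →
      ∃ ε : ℂ, (ε = 1 ∨ ε = -1) ∧ ∃ c : ℂ, c ≠ 0 ∧ x = (c, c * ε) := by
    rintro ⟨a, b⟩ hx h
    simp only [projEq2, swapC] at h
    have hab : b = a ∨ b = -a := mul_self_eq_mul_self_iff.mp h.symm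
    have ha : a ≠ 0 := by
      rintro rfl
      apply hx
      rcases hab with rfl | rfl <;> simp
    rcases hab with rfl | rfl
    · exact ⟨1, Or.inl rfl, _, ha, by simp⟩
    · exact ⟨-1, Or.inr rfl, _, ha, by simp⟩
  constructor
  · rintro ⟨h1, h2, h3⟩
    obtain ⟨e1, he1, a, ha, rfl⟩ := key u hu h1
    obtain ⟨e2, he2, b, hb, rfl⟩ := key v hv h2
    obtain ⟨e3, he3, c, hc, rfl⟩ := key w hw h3
    refine ⟨e1, e2, e3, he1, he2, he3, ?_, ⟨a, ha, rfl⟩, ⟨b, hb, rfl⟩, ⟨c, hc, rfl⟩⟩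
    have h0 : a * b * c ≠ 0 := mul_ne_zero (mul_ne_zero ha hb) hc
    apply mul_left_cancel₀ h0
    simp only at hS
    linear_combination hS
  · rintro ⟨e1, e2, e3, he1, he2, he3, -, ⟨a, -, rfl⟩, ⟨b, -, rfl⟩, ⟨c, -, rfl⟩⟩
    refine ⟨?_, ?_, ?_⟩ <;> simp only [projEq2, swapC]
    · rcases he1 with rfl | rfl <;> ring
    · rcases he2 with rfl | rfl <;> ring
    · rcases he3 with rfl | rfl <;> ring
end
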